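/- arXiv:2512.10556 — 2 statements merged into one kernel-verified Lean document; each statement's English description precedes it below -/
import Mathlib

section
/- For every τ ∈ ℍ and all z₁, z₂, t ∈ ℂ: (i) R(τ+1, z₁, z₂, t) = e^{5πi/6} · R(τ, z₁, z₂, t); (ii) (2τ−1)^{−1} · R( −τ/(2τ−1), z₁/(2τ−1), z₂/(2τ−1), t − (z₁²+z₂²)/(2τ−1) ) = e^{2πi/3} · R(τ, z₁, z₂, t). -/
noncomputable section

open Complex Real UpperHalfPlane

/-- `ϑ₁₁(τ,z) := q^{1/8} e^{−πi(z+1/2)} ∏_{n=1}^∞ (1−q^n)(1−e^{2πiz}q^{n−1})(1−e^{−2πiz}q^n)`,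
where `q = e^{2πiτ}`. -/
def th11 (τ z : ℂ) : ℂ :=
  Complex.exp (2 * (π : ℂ) * Complex.I * τ / 8) *
  Complex.exp (-(π : ℂ) * Complex.I * (z + 1 / 2)) *
  ∏' n : ℕ,
    ((1 - Complex.exp (2 * (π : ℂ) * Complex.I * τ * ((n : ℂ) + 1))) *
     (1 - Complex.exp (2 * (π : ℂ) * Complex.I * z) *
        Complex.exp (2 * (π : ℂ) * Complex.I * τ * (n : ℂ))) *
     (1 - Complex.exp (-(2 * (π : ℂ) * Complex.I * z)) *
        Complex.exp (2 * (π : ℂ) * Complex.I * τ * ((n : ℂ) + 1))))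

/-- The Dedekind eta function `η(τ) := q^{1/24} ∏_{n=1}^∞ (1−q^n)`, `q = e^{2πiτ}`. -/
def dedekindEta (τ : ℂ) : ℂ :=
  Complex.exp (2 * (π : ℂ) * Complex.I * τ / 24) *
  ∏' n : ℕ, (1 - Complex.exp (2 * (π : ℂ) * Complex.I * τ * ((n : ℂ) + 1)))

/-- The `C₂⁽¹⁾` Weyl–Kac denominator
`R(τ,z₁,z₂,t) := e^{6πit} η(τ)^{−2} ϑ₁₁(τ,z₁) ϑ₁₁(τ,z₂) ϑ₁₁(τ,z₁−z₂) ϑ₁₁(τ,z₁+z₂)`. -/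
def Rden (τ z₁ z₂ t : ℂ) : ℂ :=
  Complex.exp (6 * (π : ℂ) * Complex.I * t) * (dedekindEta τ) ^ (-2 : ℤ) *
    th11 τ z₁ * th11 τ z₂ * th11 τ (z₁ - z₂) * th11 τ (z₁ + z₂)

def qg (q : ℂ) : ℕ → ℕ → ℂ
  | _, 0 => 1
  | 0, _ + 1 => 0
  | n + 1, k + 1 => qg q n k + q ^ (k + 1) * qg q n (k + 1)

def qc (q : ℂ) (n : ℕ) : ℂ := ∏ i ∈ Finset.range n, (1 - q ^ (i + 1))

lemma qc_succ (q : ℂ) (n : ℕ) : qc q (n + 1) = qc q n * (1 - q ^ (n + 1)) := by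
  simp [qc, Finset.prod_range_succ]

lemma qg_zero_right (q : ℂ) (n : ℕ) : qg q n 0 = 1 := by cases n <;> rfl

lemma qg_succ (q : ℂ) (n k : ℕ) :
    qg q (n + 1) (k + 1) = qg q n k + q ^ (k + 1) * qg q n (k + 1) := rfl

lemma qg_gt (q : ℂ) (n : ℕ) : ∀ k, n < k → qg q n k = 0 := by
  induction n with
  | zero => intro k hk; obtain ⟨k, rfl⟩ := Nat.exists_eq_succ_of_ne_zero (by omega : k ≠ 0); rfl
  | succ n ih =>
    intro k hk
    obtain ⟨k, rfl⟩ := Nat.exists_eq_succ_of_ne_zero (by omega : k ≠ 0)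
    rw [Nat.succ_eq_add_one, qg_succ, ih k (by omega), ih (k + 1) (by omega)]; simp

lemma qg_mul (q : ℂ) (n : ℕ) : ∀ k j, k + j = n → qg q n k * (qc q k * qc q j) = qc q n := by
  induction n with
  | zero => intro k j h; obtain rfl : k = 0 := by omega
            obtain rfl : j = 0 := by omega
            simp [qg_zero_right, qc]
  | succ n ih =>
    intro k j h
    rcases k with _ | k
    · obtain rfl : j = n + 1 := by omega
      simp [qg_zero_right, qc]
    · rcases j with _ | j
      · obtain rfl : k = n := by omega
        have := ih k 0 (by omega)
        rw [qg_succ, qg_gt q k (k + 1) (by omega), qc_succ]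
        linear_combination (1 - q ^ (k + 1)) * this
      · have h1 := ih k (j + 1) (by omega)
        have h2 := ih (k + 1) j (by omega)
        rw [qg_succ, qc_succ q n, qc_succ q k, qc_succ q j]
        rw [qc_succ q j] at h1
        rw [qc_succ q k] at h2
        obtain rfl : n = k + j + 1 := by omega
        linear_combination (1 - q ^ (k + 1)) * h1 + q ^ (k + 1) * (1 - q ^ (j + 1)) * h2

lemma qbinom (q : ℂ) (n : ℕ) : ∀ y : ℂ, ∏ i ∈ Finset.range n, (1 - y * q ^ i) =
    ∑ k ∈ Finset.range (n + 1), (-1) ^ k * qg q n k * q ^ (k.choose 2) * y ^ k := by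
  induction n with
  | zero => intro y; simp [qg_zero_right]
  | succ n ih =>
    intro y
    rw [Finset.prod_range_succ']
    have h1 : ∀ i, 1 - y * q ^ (i + 1) = 1 - (y * q) * q ^ i := fun i => by ring
    simp only [h1]
    rw [ih, Finset.sum_range_succ' _ (n + 1)]
    have h2 : ∀ k, (-1) ^ (k + 1) * qg q (n + 1) (k + 1) * q ^ ((k + 1).choose 2) * y ^ (k + 1)
       = (-1) ^ (k + 1) * qg q n (k + 1) * q ^ ((k + 1).choose 2) * (y * q) ^ (k + 1)
        - y * ((-1) ^ k * qg q n k * q ^ (k.choose 2) * (y * q) ^ k) := fun k => by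
      have : (k + 1).choose 2 = k + k.choose 2 := by simp [Nat.choose_succ_succ' k 1]
      rw [qg_succ, this]; ring
    simp only [h2]
    rw [Finset.sum_sub_distrib, ← Finset.mul_sum]
    have h3 := Finset.sum_range_succ' (fun k => (-1) ^ k * qg q n k * q ^ (k.choose 2) * (y * q) ^ k) (n + 1)
    rw [Finset.sum_range_succ, qg_gt q n (n + 1) (by omega)] at h3
    simp only [qg_zero_right] at h3 ⊢
    simp at h3 ⊢
    linear_combination h3

def eT (τ z : ℂ) (m : ℤ) : ℂ := jacobiTheta₂_term m (z + 1 / 2 - τ / 2) τ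

lemma eT_succ (τ z : ℂ) (m : ℤ) : eT τ z (m + 1) =
    eT τ z m * (-(cexp (2 * π * Complex.I * z) * cexp (2 * π * Complex.I * τ * m))) := by
  unfold eT jacobiTheta₂_term
  rw [← Complex.exp_add, neg_eq_neg_one_mul, ← Complex.exp_pi_mul_I, ← Complex.exp_add,
    ← Complex.exp_add]
  congr 1
  push_cast
  ring

lemma eT_zero (τ z : ℂ) : eT τ z 0 = 1 := by simp [eT, jacobiTheta₂_term]

lemma qpow (τ : ℂ) (n : ℕ) : cexp (2 * π * Complex.I * τ * n) = cexp (2 * π * Complex.I * τ) ^ n := by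
  rw [← Complex.exp_nat_mul]; congr 1; ring

lemma qpow1 (τ : ℂ) (n : ℕ) : cexp (2 * π * Complex.I * τ * (n + 1)) = cexp (2 * π * Complex.I * τ) ^ (n + 1) := by
  rw [← Complex.exp_nat_mul]; congr 1; push_cast; ring

lemma eT_shift (τ z : ℂ) (N k : ℕ) : eT τ z (k - N) = eT τ z (-N) *
    ((-1) ^ k * cexp (2 * π * Complex.I * τ) ^ (k.choose 2) *
      (cexp (2 * π * Complex.I * z) * (cexp (2 * π * Complex.I * τ))⁻¹ ^ N) ^ k) := by
  induction k with
  | zero => simp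
  | succ k ih =>
    have : (k + 1).choose 2 = k + k.choose 2 := by simp [Nat.choose_succ_succ' k 1]
    have h0 : ((k + 1 : ℕ) : ℤ) - N = ((k : ℤ) - N) + 1 := by push_cast; ring
    rw [h0, eT_succ, ih, this]
    have : cexp (2 * π * Complex.I * τ * ((k - N : ℤ) : ℂ)) =
        cexp (2 * π * Complex.I * τ) ^ k * (cexp (2 * π * Complex.I * τ))⁻¹ ^ N := by
      rw [← Complex.exp_neg, ← Complex.exp_nat_mul, ← Complex.exp_nat_mul, ← Complex.exp_add]
      congr 1; push_cast; ring
    rw [this]; ring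

lemma half_prod (τ z : ℂ) (N : ℕ) : eT τ z (-N) * ∏ i ∈ Finset.range N,
      (1 - (cexp (2 * π * Complex.I * z) * (cexp (2 * π * Complex.I * τ))⁻¹ ^ N) * cexp (2 * π * Complex.I * τ) ^ i) =
    ∏ i ∈ Finset.range N, (1 - (cexp (2 * π * Complex.I * z))⁻¹ * cexp (2 * π * Complex.I * τ) ^ (i + 1)) := by
  induction N with
  | zero => simp [eT_zero]
  | succ N ih =>
    have hs := eT_succ τ z (-((N + 1 : ℕ) : ℤ))
    rw [show -((N + 1 : ℕ) : ℤ) + 1 = -(N : ℤ) by push_cast; ring] at hs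
    have hq : cexp (2 * π * Complex.I * τ) ≠ 0 := Complex.exp_ne_zero _
    have hx : cexp (2 * π * Complex.I * z) ≠ 0 := Complex.exp_ne_zero _
    have h1 : cexp (2 * π * Complex.I * τ * ((-((N + 1 : ℕ) : ℤ) : ℤ) : ℂ)) =
        (cexp (2 * π * Complex.I * τ))⁻¹ ^ (N + 1) := by
      rw [← Complex.exp_neg, ← Complex.exp_nat_mul]
      congr 1; push_cast; ring
    rw [h1] at hs
    rw [Finset.prod_range_succ', Finset.prod_range_succ, ← ih, hs]
    have h2 : ∀ i, (cexp (2 * π * Complex.I * z) * (cexp (2 * π * Complex.I * τ))⁻¹ ^ (N + 1)) *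
        cexp (2 * π * Complex.I * τ) ^ (i + 1) =
        (cexp (2 * π * Complex.I * z) * (cexp (2 * π * Complex.I * τ))⁻¹ ^ N) * cexp (2 * π * Complex.I * τ) ^ i := by
      intro i
      rw [inv_pow, inv_pow]
      field_simp
      ring
    simp only [h2]
    generalize ∏ i ∈ Finset.range N, (_ : ℂ) = P
    generalize cexp (2 * π * Complex.I * τ) = q at *
    generalize cexp (2 * π * Complex.I * z) = x at *
    rw [inv_pow]
    field_simp
    ring

lemma finite_jtp (τ z : ℂ) (N : ℕ) : ∏ i ∈ Finset.range N,
      ((1 - cexp (2 * π * Complex.I * z) * cexp (2 * π * Complex.I * τ) ^ i) *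
       (1 - (cexp (2 * π * Complex.I * z))⁻¹ * cexp (2 * π * Complex.I * τ) ^ (i + 1))) =
    ∑ k ∈ Finset.range (N + N + 1), qg (cexp (2 * π * Complex.I * τ)) (N + N) k * eT τ z (k - N) := by
  have hq : cexp (2 * π * Complex.I * τ) ≠ 0 := Complex.exp_ne_zero _
  have h := qbinom (cexp (2 * π * Complex.I * τ)) (N + N)
    (cexp (2 * π * Complex.I * z) * (cexp (2 * π * Complex.I * τ))⁻¹ ^ N)
  rw [Finset.prod_range_add] at h
  have h2 : ∀ i, (cexp (2 * π * Complex.I * z) * (cexp (2 * π * Complex.I * τ))⁻¹ ^ N) *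
      cexp (2 * π * Complex.I * τ) ^ (N + i) = cexp (2 * π * Complex.I * z) * cexp (2 * π * Complex.I * τ) ^ i := by
    intro i
    rw [pow_add, inv_pow]
    field_simp
  simp only [h2] at h
  rw [Finset.prod_mul_distrib, ← half_prod]
  have h3 := congrArg (fun u => eT τ z (-N) * u) h
  simp only [Finset.mul_sum] at h3
  rw [mul_comm, mul_assoc, h3]
  refine Finset.sum_congr rfl fun k _ => ?_
  rw [eT_shift]; ring

lemma sum_to_int (N : ℕ) (f : ℕ → ℂ) (g : ℤ → ℂ) :
    ∑ k ∈ Finset.range (N + N + 1), f k * g (k - N) =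
    ∑' m : ℤ, (if m ∈ Finset.Icc (-N : ℤ) N then f (m + N).toNat * g m else 0) := by
  rw [tsum_eq_sum (s := Finset.Icc (-N : ℤ) N) (fun b hb => if_neg hb), ← Finset.sum_filter]
  refine Finset.sum_bij' (fun k _ => (k : ℤ) - N) (fun m _ => (m + N).toNat) ?_ ?_ ?_ ?_ ?_
  · intro a ha; simp at ha ⊢; omega
  · intro a ha; simp at ha ⊢; omega
  · intro a ha; simp
  · intro a ha; simp at ha ⊢; omega
  · intro a ha; simp

lemma norm_q_lt {τ : ℂ} (hτ : 0 < τ.im) : ‖cexp (2 * π * Complex.I * τ)‖ < 1 := by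
  simpa using norm_exp_two_pi_I_lt_one ⟨τ, hτ⟩

def Qi (q : ℂ) : ℂ := ∏' n : ℕ, (1 - q ^ (n + 1))

lemma qc_tendsto {q : ℂ} (hq : ‖q‖ < 1) : Filter.Tendsto (qc q) Filter.atTop (nhds (Qi q)) :=
  (ModularForm.multipliable_one_sub_pow hq).hasProd.tendsto_prod_nat

lemma one_sub_ne {q : ℂ} (hq : ‖q‖ < 1) (n : ℕ) : 1 - q ^ (n + 1) ≠ 0 := by
  intro h
  have h1 : ‖q ^ (n + 1)‖ < 1 := by
    rw [norm_pow]; exact pow_lt_one₀ (norm_nonneg _) hq (by omega)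
  rw [← sub_eq_zero.mp h] at h1
  simp at h1

lemma qc_ne {q : ℂ} (hq : ‖q‖ < 1) (n : ℕ) : qc q n ≠ 0 :=
  Finset.prod_ne_zero_iff.mpr fun i _ => one_sub_ne hq i

lemma Qi_ne {q : ℂ} (hq : ‖q‖ < 1) : Qi q ≠ 0 := by
  refine tprod_one_add_ne_zero_of_summable (f := fun n : ℕ ↦ -q ^ (n + 1)) ?_ ?_
  · intro i; simpa [sub_eq_add_neg] using one_sub_ne hq i
  · simpa using (summable_nat_add_iff 1).mpr (summable_geometric_of_lt_one (norm_nonneg _) hq)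

lemma qg_eq {q : ℂ} (hq : ‖q‖ < 1) (k j : ℕ) : qg q (k + j) k =
    qc q (k + j) * (qc q k)⁻¹ * (qc q j)⁻¹ := by
  have := qg_mul q (k + j) k j rfl
  have h1 := qc_ne hq k
  have h2 := qc_ne hq j
  field_simp
  linear_combination this

lemma qg_bound {q : ℂ} (hq : ‖q‖ < 1) : ∃ C : ℝ, 0 ≤ C ∧ ∀ n k, ‖qg q n k‖ ≤ C := by
  obtain ⟨A, hA⟩ := (qc_tendsto hq).norm.bddAbove_range
  obtain ⟨B, hB⟩ := ((qc_tendsto hq).inv₀ (Qi_ne hq)).norm.bddAbove_range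
  have hA' : ∀ n, ‖qc q n‖ ≤ A := fun n => hA ⟨n, rfl⟩
  have hB' : ∀ n, ‖(qc q n)⁻¹‖ ≤ B := fun n => hB ⟨n, rfl⟩
  have hA0 : 0 ≤ A := (norm_nonneg _).trans (hA' 0)
  have hB0 : 0 ≤ B := (norm_nonneg _).trans (hB' 0)
  refine ⟨A * B * B, by positivity, fun n k => ?_⟩
  by_cases h : k ≤ n
  · obtain ⟨j, rfl⟩ := Nat.exists_eq_add_of_le h
    rw [qg_eq hq, norm_mul, norm_mul]
    gcongr
    · exact hA' _
    · exact hB' _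
    · exact hB' _
  · rw [qg_gt q n k (by omega)]; simp; positivity

lemma jtp_limit {τ : ℂ} (hτ : 0 < τ.im) (z : ℂ) : Filter.Tendsto (fun N : ℕ => ∏ i ∈ Finset.range N,
      ((1 - cexp (2 * π * Complex.I * z) * cexp (2 * π * Complex.I * τ) ^ i) *
       (1 - (cexp (2 * π * Complex.I * z))⁻¹ * cexp (2 * π * Complex.I * τ) ^ (i + 1)))) Filter.atTop
    (nhds ((Qi (cexp (2 * π * Complex.I * τ)))⁻¹ * jacobiTheta₂ (z + 1 / 2 - τ / 2) τ)) := by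
  have hq := norm_q_lt hτ
  simp only [finite_jtp, sum_to_int]
  set q := cexp (2 * π * Complex.I * τ)
  obtain ⟨C, hC0, hC⟩ := qg_bound hq
  have hs : Summable (eT τ z) := (summable_jacobiTheta₂_term_iff _ _).mpr hτ
  rw [jacobiTheta₂, ← tsum_mul_left]
  refine tendsto_tsum_of_dominated_convergence (bound := fun m => C * ‖eT τ z m‖)
    (hs.norm.mul_left C) ?_ ?_
  · intro m
    have h1 : Filter.Tendsto (fun N : ℕ => N + N) Filter.atTop Filter.atTop :=
      Filter.tendsto_atTop_mono (fun n => Nat.le_add_right n n) Filter.tendsto_id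
    have h2 : Filter.Tendsto (fun N : ℕ => (m + N).toNat) Filter.atTop Filter.atTop := by
      refine Filter.tendsto_atTop.mpr fun b => ?_
      filter_upwards [Filter.eventually_ge_atTop (b + m.natAbs)] with N hN
      omega
    have h3 : Filter.Tendsto (fun N : ℕ => (N - m).toNat) Filter.atTop Filter.atTop := by
      refine Filter.tendsto_atTop.mpr fun b => ?_
      filter_upwards [Filter.eventually_ge_atTop (b + m.natAbs)] with N hN
      omega
    have ht := qc_tendsto hq
    have ht' := ht.inv₀ (Qi_ne hq)
    have h4 := ((((ht.comp h1).mul (ht'.comp h2)).mul (ht'.comp h3)).mul_const (eT τ z m))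
    rw [mul_inv_cancel₀ (Qi_ne hq), one_mul] at h4
    refine h4.congr' ?_
    filter_upwards [Filter.eventually_ge_atTop m.natAbs] with N hN
    rw [if_pos (by simp; omega)]
    have := qg_eq hq (m + N).toNat (N - m).toNat
    rw [show (m + N).toNat + (N - m).toNat = N + N by omega] at this
    rw [this]
    rfl
  · refine Filter.Eventually.of_forall fun N m => ?_
    split_ifs
    · rw [norm_mul]; gcongr; exact hC _ _
    · simp; positivity

lemma th11_eq {τ : ℂ} (hτ : 0 < τ.im) (z : ℂ) : th11 τ z =
    cexp (2 * π * Complex.I * τ / 8) * cexp (-π * Complex.I * (z + 1 / 2)) *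
      jacobiTheta₂ (z + 1 / 2 - τ / 2) τ := by
  have hq := norm_q_lt hτ
  unfold th11
  congr 1
  simp only [qpow1, qpow, Complex.exp_neg]
  set q := cexp (2 * π * Complex.I * τ)
  set x := cexp (2 * π * Complex.I * z)
  have hsum : Summable (fun n : ℕ => ‖q‖ ^ n) := summable_geometric_of_lt_one (norm_nonneg _) hq
  have m1 := ModularForm.multipliable_one_sub_pow hq
  have m2 : Multipliable fun n : ℕ ↦ 1 - x * q ^ n := by
    apply multipliable_one_add_of_summable (f := fun n ↦ -(x * q ^ n))
    simpa using hsum.mul_left _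
  have m3 : Multipliable fun n : ℕ ↦ 1 - x⁻¹ * q ^ (n + 1) := by
    apply multipliable_one_add_of_summable (f := fun n ↦ -(x⁻¹ * q ^ (n + 1)))
    simpa using ((summable_nat_add_iff 1).mpr hsum).mul_left _
  have h := ((m1.mul m2).mul m3).hasProd.tendsto_prod_nat
  have h' := (qc_tendsto hq).mul (jtp_limit hτ z)
  rw [mul_inv_cancel_left₀ (Qi_ne hq)] at h'
  refine tendsto_nhds_unique h (h'.congr fun N => ?_)
  unfold qc
  rw [← Finset.prod_mul_distrib]
  refine Finset.prod_congr rfl fun i _ => ?_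
  ring

lemma th11_S {τ : ℂ} (hτ : 0 < τ.im) (z : ℂ) : th11 (-1 / τ) (z / τ) =
    -Complex.I * (-Complex.I * τ) ^ (1 / 2 : ℂ) * cexp (π * Complex.I * z ^ 2 / τ) * th11 τ z := by
  have h0 : τ ≠ 0 := by rintro rfl; simp at hτ
  have hτ' : 0 < (-1 / τ).im := by
    simpa [neg_div] using UpperHalfPlane.im_pnat_div_pos 1 ⟨τ, hτ⟩
  rw [th11_eq hτ', th11_eq hτ]
  have e1 : z / τ + 1 / 2 - -1 / τ / 2 = ((z + 1 / 2 - τ / 2) + τ) / τ := by field_simp; ring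
  have hf := jacobiTheta₂_functional_equation ((z + 1 / 2 - τ / 2) + τ) τ
  rw [← e1, jacobiTheta₂_add_left'] at hf
  have hs : (-Complex.I * τ) ^ (1 / 2 : ℂ) ≠ 0 := by
    rw [Complex.cpow_ne_zero_iff]; left; simp [h0]
  have hf2 : jacobiTheta₂ (z / τ + 1 / 2 - -1 / τ / 2) (-1 / τ) =
      (-Complex.I * τ) ^ (1 / 2 : ℂ) * cexp (π * Complex.I * (z + 1 / 2 - τ / 2 + τ) ^ 2 / τ) *
      (cexp (-π * Complex.I * (τ + 2 * (z + 1 / 2 - τ / 2))) * jacobiTheta₂ (z + 1 / 2 - τ / 2) τ) := by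
    rw [hf]
    have : cexp (π * Complex.I * (z + 1 / 2 - τ / 2 + τ) ^ 2 / τ) *
        cexp (-π * Complex.I * (z + 1 / 2 - τ / 2 + τ) ^ 2 / τ) = 1 := by
      rw [← Complex.exp_add, ← Complex.exp_zero]; congr 1; ring
    generalize jacobiTheta₂ _ (-1 / τ) = J at *
    generalize cexp (π * Complex.I * (z + 1 / 2 - τ / 2 + τ) ^ 2 / τ) = u at *
    generalize cexp (-π * Complex.I * (z + 1 / 2 - τ / 2 + τ) ^ 2 / τ) = v at *
    field_simp
    linear_combination (-J) * this
  rw [hf2]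
  have hI : -Complex.I = cexp (-π / 2 * Complex.I) := by
    rw [neg_div, neg_mul, Complex.exp_neg, Complex.exp_pi_div_two_mul_I, Complex.inv_I]
  have key : cexp (2 * π * Complex.I * (-1 / τ) / 8) * cexp (-π * Complex.I * (z / τ + 1 / 2)) *
      (cexp (π * Complex.I * (z + 1 / 2 - τ / 2 + τ) ^ 2 / τ) *
       cexp (-π * Complex.I * (τ + 2 * (z + 1 / 2 - τ / 2)))) =
      -Complex.I * cexp (π * Complex.I * z ^ 2 / τ) * (cexp (2 * π * Complex.I * τ / 8) * cexp (-π * Complex.I * (z + 1 / 2))) := by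
    rw [hI]
    simp only [← Complex.exp_add]
    congr 1
    field_simp
    ring
  linear_combination ((-Complex.I * τ) ^ (1 / 2 : ℂ) * jacobiTheta₂ (z + 1 / 2 - τ / 2) τ) * key

lemma eta_eq (τ : ℂ) : dedekindEta τ = ModularForm.eta τ := by
  unfold dedekindEta ModularForm.eta
  simp only [ModularForm.eta_q_eq_pow, qpow1]
  simp [Function.Periodic.qParam]

lemma eta_S {τ : ℂ} (hτ : 0 < τ.im) : dedekindEta (-1 / τ) ^ 2 = -Complex.I * τ * dedekindEta τ ^ 2 := by
  have h0 : τ ≠ 0 := by rintro rfl; simp at hτ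
  have h := ModularForm.eta_comp_eq_csqrt_I_inv (show τ ∈ upperHalfPlaneSet from hτ)
  simp only [Function.comp, Pi.smul_apply, Pi.mul_apply, smul_eq_mul] at h
  rw [eta_eq, eta_eq, h]
  have hs : ∀ w : ℂ, w ≠ 0 → Complex.sqrt w ^ 2 = w := fun w hw => by
    rw [_root_.sqrt_eq_exp hw, ← Complex.exp_nat_mul]
    conv_rhs => rw [← Complex.exp_log hw]
    congr 1
    push_cast
    ring
  rw [mul_pow, mul_pow, inv_pow, hs _ I_ne_zero, hs _ h0, Complex.inv_I]; ring

lemma eta_ne {τ : ℂ} (hτ : 0 < τ.im) : dedekindEta τ ≠ 0 := by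
  rw [eta_eq]; exact ModularForm.eta_ne_zero hτ

lemma R_S {τ : ℂ} (hτ : 0 < τ.im) (z₁ z₂ t : ℂ) :
    Rden (-1 / τ) (z₁ / τ) (z₂ / τ) (t - (z₁ ^ 2 + z₂ ^ 2) / (2 * τ)) =
      -Complex.I * τ * Rden τ z₁ z₂ t := by
  have h0 : τ ≠ 0 := by rintro rfl; simp at hτ
  have hp : ((-Complex.I * τ) ^ (1 / 2 : ℂ)) ^ 2 = -Complex.I * τ := by
    rw [← Complex.cpow_nat_mul]; norm_num
  unfold Rden
  rw [← sub_div, ← add_div, th11_S hτ, th11_S hτ, th11_S hτ, th11_S hτ]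
  have hz : ∀ w : ℂ, w ^ (-2 : ℤ) = (w ^ 2)⁻¹ := fun w => by
    rw [zpow_neg]; rfl
  rw [hz, hz, eta_S hτ]
  have he := eta_ne hτ
  generalize (-Complex.I * τ) ^ (1 / 2 : ℂ) = s at *
  have hE : cexp (6 * π * Complex.I * (t - (z₁ ^ 2 + z₂ ^ 2) / (2 * τ))) * (cexp (π * Complex.I * z₁ ^ 2 / τ) *
      cexp (π * Complex.I * z₂ ^ 2 / τ) * cexp (π * Complex.I * (z₁ - z₂) ^ 2 / τ) *
      cexp (π * Complex.I * (z₁ + z₂) ^ 2 / τ)) = cexp (6 * π * Complex.I * t) := by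
    simp only [← Complex.exp_add]
    congr 1
    field_simp
    ring
  have hs4 : (-Complex.I * s) ^ 4 * (-Complex.I * τ * dedekindEta τ ^ 2)⁻¹ = -Complex.I * τ * (dedekindEta τ ^ 2)⁻¹ := by
    have : (-Complex.I * s) ^ 4 = (-Complex.I * τ) ^ 2 := by
      rw [← hp]; linear_combination (s ^ 4 * (Complex.I ^ 2 - 1)) * I_sq
    rw [this]
    have := I_ne_zero
    field_simp
  rw [← hE]
  linear_combination (th11 τ z₁ * th11 τ z₂ * th11 τ (z₁ - z₂) * th11 τ (z₁ + z₂) *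
    (cexp (6 * π * Complex.I * (t - (z₁ ^ 2 + z₂ ^ 2) / (2 * τ))) * (cexp (π * Complex.I * z₁ ^ 2 / τ) *
      cexp (π * Complex.I * z₂ ^ 2 / τ) * cexp (π * Complex.I * (z₁ - z₂) ^ 2 / τ) *
      cexp (π * Complex.I * (z₁ + z₂) ^ 2 / τ)))) * hs4

lemma exp_T (τ : ℂ) : cexp (2 * π * Complex.I * (τ + 1)) = cexp (2 * π * Complex.I * τ) := by
  rw [mul_add, mul_one, Complex.exp_add, Complex.exp_two_pi_mul_I, mul_one]

lemma th11_T (τ z : ℂ) : th11 (τ + 1) z = cexp (π * Complex.I / 4) * th11 τ z := by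
  unfold th11
  simp only [qpow1, qpow, exp_T]
  have : cexp (2 * π * Complex.I * (τ + 1) / 8) = cexp (π * Complex.I / 4) * cexp (2 * π * Complex.I * τ / 8) := by
    rw [← Complex.exp_add]; congr 1; ring
  rw [this]; ring

lemma eta_T (τ : ℂ) : dedekindEta (τ + 1) = cexp (π * Complex.I / 12) * dedekindEta τ := by
  unfold dedekindEta
  simp only [qpow1, exp_T]
  have : cexp (2 * π * Complex.I * (τ + 1) / 24) = cexp (π * Complex.I / 12) * cexp (2 * π * Complex.I * τ / 24) := by
    rw [← Complex.exp_add]; congr 1; ring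
  rw [this]; ring

lemma R_T (τ z₁ z₂ t : ℂ) :
    Rden (τ + 1) z₁ z₂ t = cexp (5 * π * Complex.I / 6) * Rden τ z₁ z₂ t := by
  unfold Rden
  simp only [th11_T, eta_T, mul_zpow]
  have : cexp (5 * π * Complex.I / 6) = cexp (π * Complex.I / 12) ^ (-2 : ℤ) * cexp (π * Complex.I / 4) ^ 4 := by
    rw [← Complex.exp_int_mul, ← Complex.exp_nat_mul, ← Complex.exp_add]
    congr 1; push_cast; ring
  rw [this]; ring

/-- `T`- and `ST²S`-transformation of the denominator:
`R(τ+1,z₁,z₂,t) = e^{5πi/6} R(τ,z₁,z₂,t)` and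
`(2τ−1)^{−1} R(−τ/(2τ−1), z₁/(2τ−1), z₂/(2τ−1), t − (z₁²+z₂²)/(2τ−1)) = e^{2πi/3} R(τ,z₁,z₂,t)`. -/
theorem statement11 (τ : ℍ) (z₁ z₂ t : ℂ) :
    (Rden ((τ : ℂ) + 1) z₁ z₂ t =
      Complex.exp (5 * (π : ℂ) * Complex.I / 6) * Rden (τ : ℂ) z₁ z₂ t) ∧
    ((2 * (τ : ℂ) - 1)⁻¹ *
        Rden (-(τ : ℂ) / (2 * (τ : ℂ) - 1)) (z₁ / (2 * (τ : ℂ) - 1)) (z₂ / (2 * (τ : ℂ) - 1))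
          (t - (z₁ ^ 2 + z₂ ^ 2) / (2 * (τ : ℂ) - 1)) =
      Complex.exp (2 * (π : ℂ) * Complex.I / 3) * Rden (τ : ℂ) z₁ z₂ t) := by
  refine ⟨R_T _ _ _ _, ?_⟩
  obtain ⟨τ, hτ⟩ := τ
  simp only
  have h0 : τ ≠ 0 := by rintro rfl; simp at hτ
  have hd : 2 * τ - 1 ≠ 0 := by
    intro h
    have := congrArg Complex.im h
    simp at this
    exact hτ.ne' this
  have hτ' : 0 < (-1 / τ).im := by
    simpa [neg_div] using UpperHalfPlane.im_pnat_div_pos 1 ⟨τ, hτ⟩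
  have hw : 0 < (-1 / τ + 1 + 1).im := by simpa using hτ'
  have a := R_S hw (z₁ / τ) (z₂ / τ) (t - (z₁ ^ 2 + z₂ ^ 2) / (2 * τ))
  rw [R_T, R_T, R_S hτ] at a
  have ew : -1 / τ + 1 + 1 = (2 * τ - 1) / τ := by field_simp; ring
  rw [ew] at a
  have e1 : -1 / ((2 * τ - 1) / τ) = -τ / (2 * τ - 1) := by field_simp
  have e2 : ∀ w : ℂ, w / τ / ((2 * τ - 1) / τ) = w / (2 * τ - 1) := fun w => by field_simp
  have e3 : t - (z₁ ^ 2 + z₂ ^ 2) / (2 * τ) -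
      ((z₁ / τ) ^ 2 + (z₂ / τ) ^ 2) / (2 * ((2 * τ - 1) / τ)) =
      t - (z₁ ^ 2 + z₂ ^ 2) / (2 * τ - 1) := by field_simp; ring
  rw [e1, e2, e2, e3] at a
  have e4 : cexp (2 * π * Complex.I / 3) = - (cexp (5 * π * Complex.I / 6) * cexp (5 * π * Complex.I / 6)) := by
    rw [neg_eq_neg_one_mul, ← Complex.exp_pi_mul_I, ← Complex.exp_add, ← Complex.exp_add,
      ← mul_one (cexp (2 * π * Complex.I / 3)), ← Complex.exp_two_pi_mul_I, ← Complex.exp_add]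
    congr 1; ring
  rw [a, e4]
  field_simp
  linear_combination (Rden τ z₁ z₂ t) * I_sq


end
end

section
/- Let K be an integer with K ≥ −1, set m := 2(K+3), and let n₁, n₂ be positive integers with n₁ < m, n₂ < m and n₁ − n₂ odd. Then for every τ ∈ ℍ and every z ∈ ℂ: e^{πi(K+3)τ/2} · (θ_{n₁,m} − θ_{−n₁,m})(τ, −z + 1/2 − τ/2) · (θ_{n₂,m} − θ_{−n₂,m})(τ, z + 1/2 − τ/2) = −e^{πi(n₂−n₁)/2} · (θ_{n₁+(K+3),m} − e^{πin₁} θ_{−n₁+(K+3),m})(τ, z) · (θ_{n₂−(K+3),m} − e^{−πin₂} θ_{−n₂−(K+3),m})(τ, z). (The left-hand side, multiplied by e^{4πi(K+3)t}, is the numerator of the character of the quantum Hamiltonian reduction of the admissible C₂⁽¹⁾-module L(Λ^{[K]}_{n₁,n₂}) with respect to the minimal nilpotent element, in the Neveu–Schwarz sector.) -/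
noncomputable section

open Complex Real UpperHalfPlane

/-- The Jacobi theta function
`θ_{j,m}(τ,z) := Σ_{n∈ℤ} e^{2πi m (n + j/(2m)) z} e^{2πi τ m (n + j/(2m))²}`. -/
def jacobiTh (m j : ℤ) (τ z : ℂ) : ℂ :=
  ∑' n : ℤ,
    Complex.exp (2 * (π : ℂ) * Complex.I * (m : ℂ) * ((n : ℂ) + (j : ℂ) / (2 * (m : ℂ))) * z) *
    Complex.exp (2 * (π : ℂ) * Complex.I * τ * (m : ℂ) * ((n : ℂ) + (j : ℂ) / (2 * (m : ℂ))) ^ 2)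

lemma jacobiTh_shift (N j : ℤ) (hN : N ≠ 0) (τ z : ℂ) :
    jacobiTh (2 * N) j τ (z + 1 / 2 - τ / 2) =
      Complex.exp ((π : ℂ) * Complex.I * j / 2) * Complex.exp ((π : ℂ) * Complex.I * N * z) *
        Complex.exp (-((π : ℂ) * Complex.I * N * τ / 4)) * jacobiTh (2 * N) (j - N) τ z := by
  have hN' : (N : ℂ) ≠ 0 := by exact_mod_cast hN
  unfold jacobiTh
  rw [← tsum_mul_left]
  refine tsum_congr fun n => ?_
  simp only [← Complex.exp_add]
  rw [Complex.exp_eq_exp_iff_exists_int]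
  refine ⟨N * n, ?_⟩
  push_cast
  field_simp
  ring

lemma jacobiTh_neg (m j : ℤ) (τ z : ℂ) :
    jacobiTh m j τ (-z) = jacobiTh m (-j) τ z := by
  unfold jacobiTh
  rw [← (Equiv.neg ℤ).tsum_eq]
  refine tsum_congr fun n => ?_
  simp only [← Complex.exp_add, Equiv.neg_apply]
  congr 1
  push_cast
  ring

/-- With `m = 2(K+3)`, for `τ ∈ ℍ` and `z ∈ ℂ`:
`e^{πi(K+3)τ/2} (θ_{n₁,m} − θ_{−n₁,m})(τ, −z+1/2−τ/2) (θ_{n₂,m} − θ_{−n₂,m})(τ, z+1/2−τ/2)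
 = −e^{πi(n₂−n₁)/2} (θ_{n₁+(K+3),m} − e^{πin₁} θ_{−n₁+(K+3),m})(τ,z)
   (θ_{n₂−(K+3),m} − e^{−πin₂} θ_{−n₂−(K+3),m})(τ,z)`,
the Neveu–Schwarz-sector numerator identity of the quantum Hamiltonian reduction. -/
theorem statement16 (K : ℤ) (hK : -1 ≤ K) (n₁ n₂ : ℤ)
    (hn₁ : 0 < n₁) (hn₂ : 0 < n₂)
    (hn₁' : n₁ < 2 * (K + 3)) (hn₂' : n₂ < 2 * (K + 3))
    (hodd : Odd (n₁ - n₂)) (τ : ℍ) (z : ℂ) :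
    Complex.exp ((π : ℂ) * Complex.I * ((K : ℂ) + 3) * (τ : ℂ) / 2) *
      (jacobiTh (2 * (K + 3)) n₁ (τ : ℂ) (-z + 1 / 2 - (τ : ℂ) / 2) -
        jacobiTh (2 * (K + 3)) (-n₁) (τ : ℂ) (-z + 1 / 2 - (τ : ℂ) / 2)) *
      (jacobiTh (2 * (K + 3)) n₂ (τ : ℂ) (z + 1 / 2 - (τ : ℂ) / 2) -
        jacobiTh (2 * (K + 3)) (-n₂) (τ : ℂ) (z + 1 / 2 - (τ : ℂ) / 2)) =
    -Complex.exp ((π : ℂ) * Complex.I * ((n₂ : ℂ) - (n₁ : ℂ)) / 2) *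
      (jacobiTh (2 * (K + 3)) (n₁ + (K + 3)) (τ : ℂ) z -
        Complex.exp ((π : ℂ) * Complex.I * (n₁ : ℂ)) *
          jacobiTh (2 * (K + 3)) (-n₁ + (K + 3)) (τ : ℂ) z) *
      (jacobiTh (2 * (K + 3)) (n₂ - (K + 3)) (τ : ℂ) z -
        Complex.exp (-(π : ℂ) * Complex.I * (n₂ : ℂ)) *
          jacobiTh (2 * (K + 3)) (-n₂ - (K + 3)) (τ : ℂ) z) := by
  have hN : K + 3 ≠ 0 := by omega
  simp only [jacobiTh_shift (K + 3) _ hN, jacobiTh_neg]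
  have e1 : -(n₁ - (K + 3)) = -n₁ + (K + 3) := by ring
  have e2 : -(-n₁ - (K + 3)) = n₁ + (K + 3) := by ring
  rw [e1, e2]
  generalize jacobiTh (2 * (K + 3)) (-n₁ + (K + 3)) (τ : ℂ) z = A
  generalize jacobiTh (2 * (K + 3)) (n₁ + (K + 3)) (τ : ℂ) z = B
  generalize jacobiTh (2 * (K + 3)) (n₂ - (K + 3)) (τ : ℂ) z = C
  generalize jacobiTh (2 * (K + 3)) (-n₂ - (K + 3)) (τ : ℂ) z = D
  generalize (τ : ℂ) = t
  push_cast
  have h1 : Complex.exp ((π : ℂ) * Complex.I * ((K : ℂ) + 3) * t / 2) *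
      (Complex.exp (-((π : ℂ) * Complex.I * ((K : ℂ) + 3) * t / 4)) *
      Complex.exp (-((π : ℂ) * Complex.I * ((K : ℂ) + 3) * t / 4))) = 1 := by
    rw [← Complex.exp_add, ← Complex.exp_add, ← Complex.exp_zero]; congr 1; ring
  have h2 : Complex.exp ((π : ℂ) * Complex.I * ((K : ℂ) + 3) * -z) *
      Complex.exp ((π : ℂ) * Complex.I * ((K : ℂ) + 3) * z) = 1 := by
    rw [← Complex.exp_add, ← Complex.exp_zero]; congr 1; ring
  have h3 : Complex.exp ((π : ℂ) * Complex.I * ((n₂ : ℂ) - (n₁ : ℂ)) / 2) =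
      Complex.exp ((π : ℂ) * Complex.I * n₂ / 2) * Complex.exp ((π : ℂ) * Complex.I * -n₁ / 2) := by
    rw [← Complex.exp_add]; congr 1; ring
  have h4 : Complex.exp ((π : ℂ) * Complex.I * n₁ / 2) =
      Complex.exp ((π : ℂ) * Complex.I * n₁) * Complex.exp ((π : ℂ) * Complex.I * -n₁ / 2) := by
    rw [← Complex.exp_add]; congr 1; ring
  have h5 : Complex.exp ((π : ℂ) * Complex.I * -n₂ / 2) =
      Complex.exp (-(π : ℂ) * Complex.I * n₂) * Complex.exp ((π : ℂ) * Complex.I * n₂ / 2) := by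
    rw [← Complex.exp_add]; congr 1; ring
  rw [h3, h4, h5]
  generalize Complex.exp ((π : ℂ) * Complex.I * ((K : ℂ) + 3) * t / 2) = a at *
  generalize Complex.exp (-((π : ℂ) * Complex.I * ((K : ℂ) + 3) * t / 4)) = b at *
  generalize Complex.exp ((π : ℂ) * Complex.I * ((K : ℂ) + 3) * -z) = c at *
  generalize Complex.exp ((π : ℂ) * Complex.I * ((K : ℂ) + 3) * z) = d at *
  generalize Complex.exp ((π : ℂ) * Complex.I * n₁) = e at *
  generalize Complex.exp ((π : ℂ) * Complex.I * -n₁ / 2) = f at *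
  generalize Complex.exp (-(π : ℂ) * Complex.I * n₂) = g at *
  generalize Complex.exp ((π : ℂ) * Complex.I * n₂ / 2) = h at *
  calc _ = (a * (b * b)) * (c * d) * ((e * f * A - f * B) * (h * C - g * h * D)) := by ring
    _ = _ := by rw [h1, h2]; ring

end
end
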